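/- (Proposition 1, equation (8)) Let each sample's logits depend on encoder weights: lₖ : E → Fin T → Fin d → ℝ is differentiable at W₀ ∈ E for every k, and every ground-truth path yₖ is legal. Then for every c ∈ ℝ the maps W ↦ ℒ(W, Ā(A₀, c)) and W ↦ ℒ'(W, A₀) are differentiable at W₀, and the Fréchet derivative of W ↦ ℒ(W, Ā(A₀, c)) at W₀ converges, in operator norm, to the Fréchet derivative of W ↦ ℒ'(W, A₀) at W₀ as c → -∞. -/

import Mathlib

open Finset Filter Topology

/-- The score of a path `p` given emission logits `l` and transition matrix `A`:
the sum of emission scores plus the sum of transition scores over consecutive pairs. -/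
def score {n d : ℕ} (l : Fin (n + 1) → Fin d → ℝ) (A : Fin d → Fin d → ℝ)
    (p : Fin (n + 1) → Fin d) : ℝ :=
  (∑ i, l i (p i)) + ∑ i : Fin n, A (p i.castSucc) (p i.succ)

/-- The masked transition matrix: entries in the illegal set `Ω` are replaced by `c`. -/
def masked {d : ℕ} (Ω : Finset (Fin d × Fin d)) (A : Fin d → Fin d → ℝ) (c : ℝ) :
    Fin d → Fin d → ℝ :=
  fun i j => if (i, j) ∈ Ω then c else A i j

/-- A path is legal if it contains no illegal transition. -/
def Legal {n d : ℕ} (Ω : Finset (Fin d × Fin d)) (p : Fin (n + 1) → Fin d) : Prop :=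
  ∀ i : Fin n, (p i.castSucc, p i.succ) ∉ Ω

instance {n d : ℕ} (Ω : Finset (Fin d × Fin d)) : DecidablePred (Legal (n := n) Ω) :=
  fun _ => by unfold Legal; infer_instance

/-- Partition function: sum of exponentiated scores over all paths. -/
noncomputable def partAll {n d : ℕ} (l : Fin (n + 1) → Fin d → ℝ)
    (A : Fin d → Fin d → ℝ) : ℝ :=
  ∑ p : Fin (n + 1) → Fin d, Real.exp (score l A p)

/-- Restricted partition function: sum of exponentiated scores over legal paths. -/
noncomputable def partLegal {n d : ℕ} (Ω : Finset (Fin d × Fin d))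
    (l : Fin (n + 1) → Fin d → ℝ) (A : Fin d → Fin d → ℝ) : ℝ :=
  ∑ p ∈ Finset.univ.filter (Legal Ω), Real.exp (score l A p)

/-- The CRF likelihood of a ground-truth path `y`. -/
noncomputable def Lik {n d : ℕ} (y : Fin (n + 1) → Fin d) (l : Fin (n + 1) → Fin d → ℝ)
    (A : Fin d → Fin d → ℝ) : ℝ :=
  Real.exp (score l A y) / partAll l A

/-- The masked-CRF likelihood of a ground-truth path `y`. -/
noncomputable def LikM {n d : ℕ} (Ω : Finset (Fin d × Fin d)) (y : Fin (n + 1) → Fin d)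
    (l : Fin (n + 1) → Fin d → ℝ) (A : Fin d → Fin d → ℝ) : ℝ :=
  Real.exp (score l A y) / partLegal Ω l A

/-- The CRF loss over a family of `N` training samples. -/
noncomputable def crfLoss {n d : ℕ} (N : ℕ) (l : Fin N → Fin (n + 1) → Fin d → ℝ)
    (y : Fin N → Fin (n + 1) → Fin d) (A : Fin d → Fin d → ℝ) : ℝ :=
  -(1 / (N : ℝ)) * ∑ k, Real.log (Lik (y k) (l k) A)

/-- The masked-CRF loss over a family of `N` training samples. -/
noncomputable def mcrfLoss {n d : ℕ} (Ω : Finset (Fin d × Fin d)) (N : ℕ)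
    (l : Fin N → Fin (n + 1) → Fin d → ℝ) (y : Fin N → Fin (n + 1) → Fin d)
    (A : Fin d → Fin d → ℝ) : ℝ :=
  -(1 / (N : ℝ)) * ∑ k, Real.log (LikM Ω (y k) (l k) A)

section Derivative

variable {E : Type*} [NormedAddCommGroup E] [NormedSpace ℝ E] {n d : ℕ}

/-- The Fréchet derivative of the emission part of the score of the path `p`. -/
noncomputable def emissionFDeriv (l : E → Fin (n + 1) → Fin d → ℝ) (W : E)
    (p : Fin (n + 1) → Fin d) : E →L[ℝ] ℝ :=
  fderiv ℝ (fun V => ∑ i, l V i (p i)) W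

/-- The Fréchet derivative of the log-likelihood of the path `y`, normalised over the
paths in `S`, where the path `p` has unnormalised weight `w p`. -/
noncomputable def logLikFDeriv (l : E → Fin (n + 1) → Fin d → ℝ) (W : E)
    (y : Fin (n + 1) → Fin d) (S : Finset (Fin (n + 1) → Fin d))
    (w : (Fin (n + 1) → Fin d) → ℝ) : E →L[ℝ] ℝ :=
  emissionFDeriv l W y - (∑ p ∈ S, w p)⁻¹ • ∑ p ∈ S, w p • emissionFDeriv l W p

theorem hasFDerivAt_score {l : E → Fin (n + 1) → Fin d → ℝ} {W : E}
    (hl : DifferentiableAt ℝ l W) (A : Fin d → Fin d → ℝ) (p : Fin (n + 1) → Fin d) :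
    HasFDerivAt (fun V => score (l V) A p) (emissionFDeriv l W p) W := by
  have h : DifferentiableAt ℝ (fun V => ∑ i, l V i (p i)) W :=
    DifferentiableAt.fun_sum fun i _ =>
      differentiableAt_pi.1 (differentiableAt_pi.1 hl i) (p i)
  exact h.hasFDerivAt.add_const _

theorem hasFDerivAt_log_exp_score_div {l : E → Fin (n + 1) → Fin d → ℝ} {W : E}
    (hl : DifferentiableAt ℝ l W) (A : Fin d → Fin d → ℝ) (y : Fin (n + 1) → Fin d)
    {S : Finset (Fin (n + 1) → Fin d)} (hS : S.Nonempty) :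
    HasFDerivAt
      (fun V => Real.log (Real.exp (score (l V) A y) / ∑ p ∈ S, Real.exp (score (l V) A p)))
      (logLikFDeriv l W y S fun p => Real.exp (score (l W) A p)) W := by
  have hpos (V : E) : 0 < ∑ p ∈ S, Real.exp (score (l V) A p) :=
    Finset.sum_pos (fun p _ => Real.exp_pos _) hS
  have heq : (fun V => Real.log (Real.exp (score (l V) A y) /
      ∑ p ∈ S, Real.exp (score (l V) A p))) =
      fun V => score (l V) A y - Real.log (∑ p ∈ S, Real.exp (score (l V) A p)) := by
    funext V
    rw [Real.log_div (Real.exp_ne_zero _) (hpos V).ne', Real.log_exp]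
  rw [heq]
  exact (hasFDerivAt_score hl A y).sub
    ((HasFDerivAt.fun_sum fun p _ => (hasFDerivAt_score hl A p).exp).log (hpos W).ne')

theorem hasFDerivAt_crfLoss {N : ℕ} {l : Fin N → E → Fin (n + 1) → Fin d → ℝ} {W : E}
    (hl : ∀ k, DifferentiableAt ℝ (l k) W) (y : Fin N → Fin (n + 1) → Fin d)
    (A : Fin d → Fin d → ℝ) :
    HasFDerivAt (fun V => crfLoss N (fun k => l k V) y A)
      (-(1 / (N : ℝ)) • ∑ k, logLikFDeriv (l k) W (y k) univ
        fun p => Real.exp (score (l k W) A p)) W :=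
  (HasFDerivAt.fun_sum fun k _ =>
    hasFDerivAt_log_exp_score_div (hl k) A (y k) ⟨y k, mem_univ _⟩).const_mul _

theorem hasFDerivAt_mcrfLoss {Ω : Finset (Fin d × Fin d)} {N : ℕ}
    {l : Fin N → E → Fin (n + 1) → Fin d → ℝ} {W : E}
    (hl : ∀ k, DifferentiableAt ℝ (l k) W) {y : Fin N → Fin (n + 1) → Fin d}
    (hy : ∀ k, Legal Ω (y k)) (A : Fin d → Fin d → ℝ) :
    HasFDerivAt (fun V => mcrfLoss Ω N (fun k => l k V) y A)
      (-(1 / (N : ℝ)) • ∑ k, logLikFDeriv (l k) W (y k) (univ.filter (Legal Ω))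
        fun p => Real.exp (score (l k W) A p)) W :=
  (HasFDerivAt.fun_sum fun k _ =>
    hasFDerivAt_log_exp_score_div (hl k) A (y k)
      ⟨y k, mem_filter.2 ⟨mem_univ _, hy k⟩⟩).const_mul _

end Derivative

section Limit

variable {n d : ℕ} {Ω : Finset (Fin d × Fin d)} {p : Fin (n + 1) → Fin d}

theorem score_masked_of_legal (hp : Legal Ω p) (l : Fin (n + 1) → Fin d → ℝ)
    (A : Fin d → Fin d → ℝ) (c : ℝ) : score l (masked Ω A c) p = score l A p := by
  unfold score masked
  simp only [if_neg (hp _)]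

theorem tendsto_score_masked_atBot (hp : ¬ Legal Ω p) (l : Fin (n + 1) → Fin d → ℝ)
    (A : Fin d → Fin d → ℝ) :
    Tendsto (fun c => score l (masked Ω A c) p) atBot atBot := by
  obtain ⟨i, hi⟩ : ∃ i : Fin n, (p i.castSucc, p i.succ) ∈ Ω := by
    simpa [Legal] using hp
  simp only [score, masked, Finset.sum_ite, Finset.sum_const, nsmul_eq_mul]
  refine tendsto_atBot_add_const_left _ _ (tendsto_atBot_add_const_right _ _ ?_)
  refine tendsto_id.const_mul_atBot ?_
  exact Nat.cast_pos.2 (card_pos.2 ⟨i, mem_filter.2 ⟨mem_univ _, hi⟩⟩)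

theorem tendsto_exp_score_masked (Ω : Finset (Fin d × Fin d)) (l : Fin (n + 1) → Fin d → ℝ)
    (A : Fin d → Fin d → ℝ) (p : Fin (n + 1) → Fin d) :
    Tendsto (fun c => Real.exp (score l (masked Ω A c) p)) atBot
      (𝓝 (if Legal Ω p then Real.exp (score l A p) else 0)) := by
  split_ifs with hp
  · simp only [score_masked_of_legal hp]
    exact tendsto_const_nhds
  · exact Real.tendsto_exp_atBot.comp (tendsto_score_masked_atBot hp l A)

theorem tendsto_logLikFDeriv_masked {E : Type*} [NormedAddCommGroup E] [NormedSpace ℝ E]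
    (l : E → Fin (n + 1) → Fin d → ℝ) (W : E) {y : Fin (n + 1) → Fin d}
    (hy : Legal Ω y) (A : Fin d → Fin d → ℝ) :
    Tendsto (fun c => logLikFDeriv l W y univ
        fun p => Real.exp (score (l W) (masked Ω A c) p)) atBot
      (𝓝 (logLikFDeriv l W y (univ.filter (Legal Ω))
        fun p => Real.exp (score (l W) A p))) := by
  have hpos : 0 < ∑ p ∈ univ.filter (Legal Ω), Real.exp (score (l W) A p) :=
    Finset.sum_pos (fun p _ => Real.exp_pos _) ⟨y, mem_filter.2 ⟨mem_univ _, hy⟩⟩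
  have hw := tendsto_exp_score_masked Ω (l W) A
  have hZ := tendsto_finsetSum univ fun p _ => hw p
  have hD := tendsto_finsetSum univ fun p _ => (hw p).smul_const (emissionFDeriv l W p)
  simp only [ite_smul, zero_smul] at hD
  rw [← Finset.sum_filter] at hZ hD
  exact tendsto_const_nhds.sub ((hZ.inv₀ hpos.ne').smul hD)

end Limit

/-- Proposition 1, (8): differentiability in the encoder weights of both
losses, and operator-norm convergence of the Fréchet derivative of the masked-matrix CRF
loss to the Fréchet derivative of the masked-CRF loss as `c → -∞`. -/
theorem stmt_8 {E : Type*} [NormedAddCommGroup E] [NormedSpace ℝ E]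
    {n d : ℕ} (hd : 1 ≤ d) (Ω : Finset (Fin d × Fin d))
    (N : ℕ) (hN : 1 ≤ N)
    (l : Fin N → E → Fin (n + 1) → Fin d → ℝ) (W₀ : E)
    (hl : ∀ k, DifferentiableAt ℝ (l k) W₀)
    (y : Fin N → Fin (n + 1) → Fin d) (hy : ∀ k, Legal Ω (y k))
    (A₀ : Fin d → Fin d → ℝ) :
    (∀ c : ℝ, DifferentiableAt ℝ
        (fun W => crfLoss N (fun k => l k W) y (masked Ω A₀ c)) W₀) ∧
    DifferentiableAt ℝ (fun W => mcrfLoss Ω N (fun k => l k W) y A₀) W₀ ∧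
    Tendsto (fun c : ℝ =>
        fderiv ℝ (fun W => crfLoss N (fun k => l k W) y (masked Ω A₀ c)) W₀) atBot
      (𝓝 (fderiv ℝ (fun W => mcrfLoss Ω N (fun k => l k W) y A₀) W₀)) := by
  refine ⟨fun c => (hasFDerivAt_crfLoss hl y _).differentiableAt,
    (hasFDerivAt_mcrfLoss hl hy A₀).differentiableAt, ?_⟩
  rw [(hasFDerivAt_mcrfLoss hl hy A₀).fderiv]
  simp only [fun c => (hasFDerivAt_crfLoss hl y (masked Ω A₀ c)).fderiv]
  exact (tendsto_finsetSum univ fun k _ =>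
    tendsto_logLikFDeriv_masked (l k) W₀ (hy k) A₀).const_smul _
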